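/- arXiv:2110.09620 — 4 statements merged into one kernel-verified Lean document; each statement's English description precedes it below -/
import Mathlib

section
/- (Stein's lemma, first identity.) Let X be a real random variable whose law is the Gaussian measure with mean μ and variance 1. Let g: ℝ → ℝ be differentiable, and assume that (X − μ)·g(X) and g'(X) are integrable. Then E[(X − μ) g(X)] = E[g'(X)]. -/
open MeasureTheory ProbabilityTheory

/-- **Stein's lemma, first identity.** If `X` has law `N(μ, 1)`, `g` is differentiable,
and `(X − μ)·g(X)` and `g'(X)` are integrable, then `E[(X − μ) g(X)] = E[g'(X)]`. -/
theorem stein_first_identity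
    {Ω : Type*} [MeasurableSpace Ω] (P : Measure Ω) [IsProbabilityMeasure P]
    (X : Ω → ℝ) (hX : Measurable X) (μ : ℝ)
    (hlaw : Measure.map X P = gaussianReal μ 1)
    (g : ℝ → ℝ) (hg : Differentiable ℝ g)
    (hint1 : Integrable (fun ω => (X ω - μ) * g (X ω)) P)
    (hint2 : Integrable (fun ω => deriv g (X ω)) P) :
    ∫ ω, (X ω - μ) * g (X ω) ∂P = ∫ ω, deriv g (X ω) ∂P := by
  set φ : ℝ → ℝ := gaussianPDFReal μ 1 with hφ
  have hφd : ∀ x, HasDerivAt φ (-(x - μ) * φ x) x := by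
    intro x
    have h1 : HasDerivAt (fun x : ℝ => -(x - μ) ^ 2 / (2 * ((1 : NNReal) : ℝ))) (-(x - μ)) x := by
      have := (((hasDerivAt_id x).sub_const μ).pow 2).neg.div_const (2 * ((1 : NNReal) : ℝ))
      refine this.congr_deriv ?_
      simp
      ring
    have h2 := h1.exp.const_mul (√(2 * Real.pi * ((1 : NNReal) : ℝ)))⁻¹
    rw [hφ, gaussianPDFReal_def]
    refine h2.congr_deriv ?_
    ring
  have key : ∀ f : ℝ → ℝ, Measurable f → Integrable (fun ω => f (X ω)) P →
      Integrable (fun x => φ x * f x) := by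
    intro f hf hi
    have h1 : Integrable f (Measure.map X P) :=
      (integrable_map_measure hf.aestronglyMeasurable hX.aemeasurable).2 hi
    rw [hlaw, gaussianReal_of_var_ne_zero μ one_ne_zero,
      integrable_withDensity_iff_integrable_smul' (measurable_gaussianPDF μ 1)
        (Filter.Eventually.of_forall fun _ => gaussianPDF_lt_top)] at h1
    simpa [toReal_gaussianPDF] using h1
  have keyI : ∀ f : ℝ → ℝ, Measurable f → ∫ ω, f (X ω) ∂P = ∫ x, φ x * f x := by
    intro f hf
    rw [← integral_map hX.aemeasurable hf.aestronglyMeasurable, hlaw,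
      integral_gaussianReal_eq_integral_smul one_ne_zero]
    rfl
  have hm1 : Measurable (fun x => (x - μ) * g x) :=
    (measurable_id.sub_const μ).mul hg.continuous.measurable
  have hm2 : Measurable (deriv g) := measurable_deriv g
  have i1 := key _ hm1 hint1
  have i2 := key _ hm2 hint2
  have hφc : Continuous φ := continuous_iff_continuousAt.2 fun x => (hφd x).continuousAt
  have hc : Continuous (fun x => g x * φ x) := hg.continuous.mul hφc
  have i3 : Integrable (fun x => g x * φ x) := by
    have hI : Integrable ((Set.Icc (μ - 1) (μ + 1)).indicator (fun x => g x * φ x)) :=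
      (hc.integrableOn_Icc).integrable_indicator measurableSet_Icc
    refine (i1.norm.add hI.norm).mono' hc.aestronglyMeasurable
      (Filter.Eventually.of_forall fun x => ?_)
    by_cases hx : x ∈ Set.Icc (μ - 1) (μ + 1)
    · simp only [Pi.add_apply, Set.indicator_of_mem hx]
      exact le_add_of_nonneg_left (norm_nonneg _)
    · simp only [Pi.add_apply, Set.indicator_of_notMem hx, norm_zero, add_zero]
      have h1 : 1 ≤ |x - μ| := by
        by_contra h
        have := abs_lt.1 (not_le.1 h)
        exact hx ⟨by linarith, by linarith⟩
      have : φ x * ((x - μ) * g x) = (x - μ) * (g x * φ x) := by ring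
      rw [this, norm_mul (x - μ), Real.norm_eq_abs (x - μ)]
      exact le_mul_of_one_le_left (norm_nonneg _) h1
  have main := integral_mul_deriv_eq_deriv_mul_of_integrable (u := g) (v := φ)
    (u' := deriv g) (v' := fun x => -(x - μ) * φ x)
    (fun x _ => (hg x).hasDerivAt) (fun x _ => hφd x)
    (i1.neg.congr (Filter.Eventually.of_forall fun x => by
      simp only [Pi.neg_apply, Pi.mul_apply]; ring))
    (i2.congr (Filter.Eventually.of_forall fun x => by
      simp only [Pi.mul_apply]; ring)) i3
  rw [keyI _ hm1, keyI _ hm2]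
  have e1 : ∫ x, φ x * ((x - μ) * g x) = - ∫ x, g x * (-(x - μ) * φ x) := by
    rw [← integral_neg]
    congr 1; ext x; ring
  rw [e1, main, neg_neg]
  congr 1; ext x; ring
end

section
/- (Second-order multivariate Stein identity underlying pHd, Li 1992, identity-covariance case.) Let X: Ω → ℝ^d be a random vector whose law is the standard Gaussian measure on ℝ^d, and let f: ℝ^d → ℝ be twice continuously differentiable. Assume f(X), the entries of X Xᵀ f(X), and the entries of the Hessian ∇²f(X) are all integrable. Then, entrywise, E[(f(X) − E[f(X)]) · X Xᵀ] = E[∇²f(X)]; that is, the matrix Σ_{yxx} := E[(f(X) − E[f(X)])(X − E[X])(X − E[X])ᵀ] equals the mean Hessian matrix H̄ := E[∇²f(X)]. -/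
open MeasureTheory ProbabilityTheory Matrix

/-- The `(i,j)` entry of the Hessian matrix `∇²f(x)` of `f : ℝ^d → ℝ`. -/
noncomputable def hessianEntry {d : ℕ} (f : (Fin d → ℝ) → ℝ) (x : Fin d → ℝ)
    (i j : Fin d) : ℝ :=
  fderiv ℝ (fun y => fderiv ℝ f y (Pi.single j 1)) x (Pi.single i 1)

/-- Product Gaussian density. -/
noncomputable def stdRho (d : ℕ) (x : Fin d → ℝ) : ℝ :=
  ∏ k, gaussianPDFReal 0 1 (x k)

lemma stdRho_eq (d : ℕ) : stdRho d = fun x =>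
    (∏ _k : Fin d, (√(2 * Real.pi * (1 : NNReal)))⁻¹) * Real.exp (∑ k, -(x k) ^ 2 / 2) := by
  funext x
  simp only [stdRho, gaussianPDFReal, Finset.prod_mul_distrib, Real.exp_sum]
  simp

lemma stdRho_nonneg (d : ℕ) (x) : 0 ≤ stdRho d x :=
  Finset.prod_nonneg fun _ _ => gaussianPDFReal_nonneg _ _ _

lemma stdRho_contDiff (d : ℕ) : ContDiff ℝ 1 (stdRho d) := by
  rw [stdRho_eq]
  fun_prop

lemma stdRho_fderiv (d : ℕ) (x : Fin d → ℝ) (i : Fin d) :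
    fderiv ℝ (stdRho d) x (Pi.single i 1) = -(x i * stdRho d x) := by
  have h1 : ∀ k : Fin d, HasFDerivAt (fun y : Fin d → ℝ => -(y k) ^ 2 / 2)
      ((-(x k)) • ContinuousLinearMap.proj (R := ℝ) (φ := fun _ : Fin d => ℝ) k) x := by
    intro k
    have h0 : HasFDerivAt (fun y : Fin d → ℝ => y k)
      (ContinuousLinearMap.proj (R := ℝ) (φ := fun _ : Fin d => ℝ) k) x :=
      (ContinuousLinearMap.proj (R := ℝ) (φ := fun _ : Fin d => ℝ) k).hasFDerivAt
    have h2 : HasDerivAt (fun t : ℝ => -t ^ 2 / 2) (-(x k)) (x k) := by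
      have := ((hasDerivAt_pow 2 (x k)).neg.div_const 2)
      convert! this using 1
      simp
      ring
    exact h2.comp_hasFDerivAt x h0
  have h2 := ((HasFDerivAt.fun_sum (u := Finset.univ) fun k _ => h1 k).exp).const_mul
    (∏ _k : Fin d, (√(2 * Real.pi * (1 : NNReal)))⁻¹)
  rw [stdRho_eq, h2.fderiv]
  simp [Pi.single_apply]
  ring

lemma pi_gaussian_eq (d : ℕ) : Measure.pi (fun _ : Fin d => gaussianReal 0 1) =
    (volume : Measure (Fin d → ℝ)).withDensity (fun x => ENNReal.ofReal (stdRho d x)) := by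
  apply Measure.pi_eq
  intro s hs
  have hI : Integrable (stdRho d) (volume.restrict (Set.univ.pi s)) := by
    rw [volume_pi, Measure.restrict_pi_pi]
    exact Integrable.fintype_prod (f := fun _ => gaussianPDFReal 0 1)
      (fun i => (integrable_gaussianPDFReal 0 1).restrict)
  rw [withDensity_apply _ (MeasurableSet.univ_pi hs),
    ← ofReal_integral_eq_lintegral_ofReal hI (ae_of_all _ (stdRho_nonneg d)),
    volume_pi, Measure.restrict_pi_pi]
  simp only [stdRho]
  rw [integral_fintype_prod_eq_prod (fun _ => gaussianPDFReal 0 1),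
    ENNReal.ofReal_prod_of_nonneg]
  · refine Finset.prod_congr rfl fun k _ => ?_
    rw [gaussianReal_apply_eq_integral _ one_ne_zero]
  · intro k _
    exact integral_nonneg fun _ => gaussianPDFReal_nonneg _ _ _

lemma integral_pi_gaussian (d : ℕ) (h : (Fin d → ℝ) → ℝ) :
    ∫ x, h x ∂(Measure.pi (fun _ : Fin d => gaussianReal 0 1)) = ∫ x, h x * stdRho d x := by
  rw [pi_gaussian_eq, integral_withDensity_eq_integral_toReal_smul]
  · refine integral_congr_ae (ae_of_all _ fun x => ?_)
    simp [ENNReal.toReal_ofReal (stdRho_nonneg d x), mul_comm]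
  · exact (stdRho_contDiff d).continuous.measurable.ennreal_ofReal
  · simp

lemma stein_compact {d : ℕ} (h : (Fin d → ℝ) → ℝ) (hh : ContDiff ℝ 1 h)
    (hc : HasCompactSupport h) (i : Fin d) :
    ∫ x, fderiv ℝ h x (Pi.single i 1) ∂(Measure.pi (fun _ : Fin d => gaussianReal 0 1))
    = ∫ x, x i * h x ∂(Measure.pi (fun _ : Fin d => gaussianReal 0 1)) := by
  rw [integral_pi_gaussian, integral_pi_gaussian]
  have hr := stdRho_contDiff d
  have hrc := hr.continuous
  have hhc := hh.continuous
  have hd : Continuous (fun x => fderiv ℝ h x (Pi.single i 1)) :=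
    (hh.continuous_fderiv one_ne_zero).clm_apply continuous_const
  have hd' : Continuous (fun x => fderiv ℝ (stdRho d) x (Pi.single i 1)) :=
    (hr.continuous_fderiv one_ne_zero).clm_apply continuous_const
  have key := integral_mul_fderiv_eq_neg_fderiv_mul_of_integrable
    (μ := (volume : Measure (Fin d → ℝ))) (f := h) (g := stdRho d) (v := Pi.single i 1)
    ((hd.mul hrc).integrable_of_hasCompactSupport ((hc.fderiv_apply ℝ _).mul_right))
    ((hhc.mul hd').integrable_of_hasCompactSupport (hc.mul_right))
    ((hhc.mul hrc).integrable_of_hasCompactSupport (hc.mul_right))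
    (fun x _ => hh.differentiable one_ne_zero x) (fun x _ => hr.differentiable one_ne_zero x)
  rw [← neg_eq_iff_eq_neg] at key
  rw [← key, ← integral_neg]
  refine integral_congr_ae (ae_of_all _ fun x => ?_)
  simp only [stdRho_fderiv]
  ring

lemma integrable_compact {d : ℕ} (h : (Fin d → ℝ) → ℝ) (hh : Continuous h)
    (hc : HasCompactSupport h) :
    Integrable h (Measure.pi (fun _ : Fin d => gaussianReal 0 1)) :=
  hh.integrable_of_hasCompactSupport hc

/-- integration by parts against `v` -/
lemma stein_parts {d : ℕ} (u v : (Fin d → ℝ) → ℝ) (hu : ContDiff ℝ 1 u) (hv : ContDiff ℝ 1 v)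
    (hc : HasCompactSupport v) (i : Fin d) :
    ∫ x, fderiv ℝ u x (Pi.single i 1) * v x ∂(Measure.pi (fun _ : Fin d => gaussianReal 0 1))
    = ∫ x, u x * (x i * v x - fderiv ℝ v x (Pi.single i 1))
      ∂(Measure.pi (fun _ : Fin d => gaussianReal 0 1)) := by
  have h := stein_compact (fun x => u x * v x) (hu.mul hv) hc.mul_left i
  have hdu : Continuous (fun x => fderiv ℝ u x (Pi.single i 1)) :=
    (hu.continuous_fderiv one_ne_zero).clm_apply continuous_const
  have hdv : Continuous (fun x => fderiv ℝ v x (Pi.single i 1)) :=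
    (hv.continuous_fderiv one_ne_zero).clm_apply continuous_const
  have huc := hu.continuous
  have hvc := hv.continuous
  have hi1 := integrable_compact (fun x => fderiv ℝ u x (Pi.single i 1) * v x) (hdu.mul hvc) hc.mul_left
  have hi2 := integrable_compact (fun x => u x * fderiv ℝ v x (Pi.single i 1)) (huc.mul hdv) (hc.fderiv_apply ℝ _).mul_left
  have hi3 := integrable_compact (fun x => x i * (u x * v x)) (by fun_prop)
    (HasCompactSupport.mul_left (HasCompactSupport.mul_left hc))
  have e1 : (fun x => fderiv ℝ (fun x => u x * v x) x (Pi.single i 1)) = fun x =>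
      fderiv ℝ u x (Pi.single i 1) * v x + u x * fderiv ℝ v x (Pi.single i 1) := by
    funext x
    rw [fderiv_fun_mul (hu.differentiable one_ne_zero x) (hv.differentiable one_ne_zero x)]
    simp
    ring
  rw [e1, integral_add hi1 hi2] at h
  rw [eq_sub_of_add_eq h, ← integral_sub hi3 hi2]
  refine integral_congr_ae (ae_of_all _ fun x => ?_)
  simp only
  ring

/-- second-order integration by parts against a test function. -/
lemma stein_parts2 {d : ℕ} (f v : (Fin d → ℝ) → ℝ) (hf : ContDiff ℝ 2 f) (hv : ContDiff ℝ 2 v)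
    (hc : HasCompactSupport v) (i j : Fin d) :
    ∫ x, hessianEntry f x i j * v x ∂(Measure.pi (fun _ : Fin d => gaussianReal 0 1))
    = ∫ x, f x * (x i * x j * v x - (if i = j then 1 else 0) * v x
        - x i * fderiv ℝ v x (Pi.single j 1)
        - x j * fderiv ℝ v x (Pi.single i 1) + hessianEntry v x j i)
      ∂(Measure.pi (fun _ : Fin d => gaussianReal 0 1)) := by
  have hdf : ContDiff ℝ 1 (fun x => fderiv ℝ f x (Pi.single j 1)) :=
    (hf.fderiv_right (m := 1) (by norm_num)).clm_apply contDiff_const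
  have hdv : ContDiff ℝ 1 (fun x => fderiv ℝ v x (Pi.single i 1)) :=
    (hv.fderiv_right (m := 1) (by norm_num)).clm_apply contDiff_const
  have hv1 : ContDiff ℝ 1 v := hv.of_le (by norm_num)
  have hxi : ContDiff ℝ 1 (fun x : Fin d → ℝ => x i) := by fun_prop
  unfold hessianEntry
  rw [stein_parts _ v hdf hv1 hc i,
    stein_parts f _ (hf.of_le (by norm_num)) ((hxi.mul hv1).sub hdv)
      (HasCompactSupport.sub hc.mul_left (hc.fderiv_apply ℝ _)) j]
  refine integral_congr_ae (ae_of_all _ fun x => ?_)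
  have hp : fderiv ℝ (fun x : Fin d → ℝ => x i) x
      = ContinuousLinearMap.proj (R := ℝ) (φ := fun _ : Fin d => ℝ) i :=
    (ContinuousLinearMap.proj (R := ℝ) (φ := fun _ : Fin d => ℝ) i).fderiv
  simp only
  rw [fderiv_fun_sub ((hxi.mul hv1).differentiable one_ne_zero x)
    (hdv.differentiable one_ne_zero x), fderiv_fun_mul (hxi.differentiable one_ne_zero x)
    (hv1.differentiable one_ne_zero x), hp]
  by_cases hij : i = j
  · simp [hij]
    left
    ring
  · simp [hij]
    left
    ring

lemma tendsto_cutoff {d : ℕ} (μ : Measure (Fin d → ℝ)) (g ψ : (Fin d → ℝ) → ℝ)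
    (hg : Integrable g μ) (hψ : Continuous ψ) (hc : HasCompactSupport ψ) :
    Filter.Tendsto (fun n : ℕ => ∫ x, g x * ψ ((1 / ((n : ℝ) + 1)) • x) ∂μ) Filter.atTop
      (nhds (∫ x, g x * ψ 0 ∂μ)) := by
  obtain ⟨C, hC⟩ := hc.exists_bound_of_continuous hψ
  refine tendsto_integral_of_dominated_convergence (fun x => ‖g x‖ * C) ?_ (hg.norm.mul_const C) ?_ ?_
  · intro n
    exact hg.aestronglyMeasurable.mul (by fun_prop : Continuous _).aestronglyMeasurable
  · intro n
    refine ae_of_all _ fun x => ?_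
    rw [norm_mul]
    gcongr
    exact hC _
  · refine ae_of_all _ fun x => ?_
    refine Filter.Tendsto.const_mul _ ((hψ.tendsto 0).comp ?_)
    have := (tendsto_one_div_add_atTop_nhds_zero_nat (𝕜 := ℝ)).smul_const x
    simpa using this

lemma fderiv_scale {d : ℕ} (φ : (Fin d → ℝ) → ℝ) (hφ : Differentiable ℝ φ) (c : ℝ)
    (x w : Fin d → ℝ) :
    fderiv ℝ (fun y => φ (c • y)) x w = c * fderiv ℝ φ (c • x) w := by
  have h1 : HasFDerivAt (fun y : Fin d → ℝ => c • y)
      (c • ContinuousLinearMap.id ℝ (Fin d → ℝ)) x := (hasFDerivAt_id x).const_smul c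
  have := ((hφ (c • x)).hasFDerivAt.comp x h1).fderiv
  rw [show (fun y => φ (c • y)) = φ ∘ (fun y => c • y) from rfl, this]
  simp

lemma hessian_scale {d : ℕ} (φ : (Fin d → ℝ) → ℝ) (hφ : ContDiff ℝ 2 φ) (c : ℝ)
    (x : Fin d → ℝ) (i j : Fin d) :
    hessianEntry (fun y => φ (c • y)) x i j = c * (c * hessianEntry φ (c • x) i j) := by
  have hd : ContDiff ℝ 1 (fun x => fderiv ℝ φ x (Pi.single j 1)) :=
    (hφ.fderiv_right (m := 1) (by norm_num)).clm_apply contDiff_const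
  unfold hessianEntry
  simp only [fderiv_scale φ (hφ.differentiable two_ne_zero)]
  have h2 : DifferentiableAt ℝ (fun y => fderiv ℝ φ (c • y) (Pi.single j 1)) x :=
    (hd.comp (contDiff_const_smul c)).differentiable one_ne_zero x
  rw [fderiv_const_mul h2]
  have := fderiv_scale _ (hd.differentiable one_ne_zero) c x (Pi.single i 1)
  simp [this]

lemma stein_pi {d : ℕ} (f : (Fin d → ℝ) → ℝ) (hf : ContDiff ℝ 2 f) (i j : Fin d)
    (h0 : Integrable f (Measure.pi (fun _ : Fin d => gaussianReal 0 1)))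
    (h1 : Integrable (fun x => x i * x j * f x) (Measure.pi (fun _ : Fin d => gaussianReal 0 1)))
    (h2 : Integrable (fun x => hessianEntry f x i j)
      (Measure.pi (fun _ : Fin d => gaussianReal 0 1))) :
    ∫ x, hessianEntry f x i j ∂(Measure.pi (fun _ : Fin d => gaussianReal 0 1))
    = (∫ x, x i * x j * f x ∂(Measure.pi (fun _ : Fin d => gaussianReal 0 1)))
      - (if i = j then 1 else 0) * ∫ x, f x ∂(Measure.pi (fun _ : Fin d => gaussianReal 0 1)) := by
  set μ := Measure.pi (fun _ : Fin d => gaussianReal 0 1) with hμ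
  let b : ContDiffBump (0 : Fin d → ℝ) := ⟨1, 2, one_pos, one_lt_two⟩
  let φ : (Fin d → ℝ) → ℝ := b
  have hφ : ContDiff ℝ 2 φ := b.contDiff
  have hφc : HasCompactSupport φ := b.hasCompactSupport
  have hφ0 : φ 0 = 1 := b.one_of_mem_closedBall (by simp [b])
  have hφk := hφ.continuous
  have hd : ∀ k, ContDiff ℝ 1 (fun x => fderiv ℝ φ x (Pi.single k 1)) := fun k =>
    (hφ.fderiv_right (m := 1) (by norm_num)).clm_apply contDiff_const
  have hdk := fun k => (hd k).continuous
  have hdc : ∀ k, HasCompactSupport (fun x => fderiv ℝ φ x (Pi.single k 1)) := fun k =>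
    hφc.fderiv_apply ℝ _
  have hH : Continuous (fun x => hessianEntry φ x j i) :=
    ((hd i).continuous_fderiv one_ne_zero).clm_apply continuous_const
  have hHc : HasCompactSupport (fun x => hessianEntry φ x j i) := (hdc i).fderiv_apply ℝ _
  let c : ℕ → ℝ := fun n => 1 / ((n : ℝ) + 1)
  have hc0 : Filter.Tendsto c Filter.atTop (nhds 0) := tendsto_one_div_add_atTop_nhds_zero_nat
  have hcpos : ∀ n, c n ≠ 0 := fun n => by positivity
  -- the cutoff pieces
  let δ : ℝ := if i = j then 1 else 0
  let ψ : Fin d → Fin d → (Fin d → ℝ) → ℝ := fun k l x => x k * fderiv ℝ φ x (Pi.single l 1)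
  have hψk : ∀ k l, Continuous (ψ k l) := fun k l => (continuous_apply k).mul (hdk l)
  have hψc : ∀ k l, HasCompactSupport (ψ k l) := fun k l => (hdc l).mul_left
  have tL := tendsto_cutoff μ _ φ h2 hφk hφc
  have t1 := tendsto_cutoff μ _ φ h1 hφk hφc
  have t2 := tendsto_cutoff μ _ φ h0 hφk hφc
  have t3 := tendsto_cutoff μ _ (ψ i j) h0 (hψk i j) (hψc i j)
  have t4 := tendsto_cutoff μ _ (ψ j i) h0 (hψk j i) (hψc j i)
  have t5 := tendsto_cutoff μ _ _ h0 hH hHc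
  have intg : ∀ (g ψ : (Fin d → ℝ) → ℝ) (n : ℕ), Integrable g μ → Continuous ψ →
      HasCompactSupport ψ → Integrable (fun x => g x * ψ (c n • x)) μ := by
    intro g ψ n hg hψ hc
    obtain ⟨C, hC⟩ := hc.exists_bound_of_continuous hψ
    exact hg.mul_bdd (c := C) (by fun_prop : Continuous _).aestronglyMeasurable
      (ae_of_all _ fun x => hC _)
  have key : ∀ n : ℕ, ∫ x, hessianEntry f x i j * φ (c n • x) ∂μ =
      (∫ x, x i * x j * f x * φ (c n • x) ∂μ) - δ * (∫ x, f x * φ (c n • x) ∂μ)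
      - (∫ x, f x * ψ i j (c n • x) ∂μ) - (∫ x, f x * ψ j i (c n • x) ∂μ)
      + c n * c n * (∫ x, f x * hessianEntry φ (c n • x) j i ∂μ) := by
    intro n
    have i1 := intg _ φ n h1 hφk hφc
    have i2 := (intg _ φ n h0 hφk hφc).const_mul δ
    have i3 := intg _ (ψ i j) n h0 (hψk i j) (hψc i j)
    have i4 := intg _ (ψ j i) n h0 (hψk j i) (hψc j i)
    have i5 := (intg _ _ n h0 hH hHc).const_mul (c n * c n)
    have i12 : Integrable (fun x => x i * x j * f x * φ (c n • x) - δ * (f x * φ (c n • x))) μ :=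
      i1.sub i2
    have i123 : Integrable (fun x => x i * x j * f x * φ (c n • x) - δ * (f x * φ (c n • x))
      - f x * ψ i j (c n • x)) μ := i12.sub i3
    have i1234 : Integrable (fun x => x i * x j * f x * φ (c n • x) - δ * (f x * φ (c n • x))
      - f x * ψ i j (c n • x) - f x * ψ j i (c n • x)) μ := i123.sub i4
    have hvc : HasCompactSupport (fun x => φ (c n • x)) :=
      hφc.comp_homeomorph (Homeomorph.smulOfNeZero (c n) (hcpos n))
    rw [hμ, stein_parts2 f (fun x => φ (c n • x)) hf (hφ.comp (contDiff_const_smul (c n))) hvc i j,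
      ← hμ, ← integral_const_mul, ← integral_const_mul, ← integral_sub i1 i2,
      ← integral_sub i12 i3, ← integral_sub i123 i4, ← integral_add i1234 i5]
    refine integral_congr_ae (ae_of_all _ fun x => ?_)
    simp only [hessian_scale φ hφ, fderiv_scale φ (hφ.differentiable two_ne_zero), ψ, δ,
      Pi.smul_apply, smul_eq_mul]
    split_ifs <;> ring
  have tR := ((((t1.sub (t2.const_mul δ)).sub t3).sub t4).add ((hc0.mul hc0).mul t5))
  have tL' := tL.congr key
  have := tendsto_nhds_unique tL' tR
  simpa [hφ0, ψ, δ] using this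

lemma coord_integrable {d : ℕ} (i j : Fin d) :
    Integrable (fun x : Fin d → ℝ => x i * x j)
      (Measure.pi (fun _ : Fin d => gaussianReal 0 1)) := by
  have h : ∀ k, MemLp (fun x : Fin d → ℝ => x k) 2
      (Measure.pi (fun _ : Fin d => gaussianReal 0 1)) := fun k =>
    (memLp_id_gaussianReal' 2 (by simp)).comp_measurePreserving (measurePreserving_eval _ k)
  exact (h i).integrable_mul (h j)

lemma coord_mean {d : ℕ} (i : Fin d) :
    ∫ x : Fin d → ℝ, x i ∂(Measure.pi (fun _ : Fin d => gaussianReal 0 1)) = 0 := by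
  rw [integral_comp_eval (μ := fun _ : Fin d => gaussianReal 0 1) (i := i) (f := fun t => t)
    (by fun_prop)]
  exact integral_id_gaussianReal

lemma coord_cov {d : ℕ} (i j : Fin d) :
    ∫ x : Fin d → ℝ, x i * x j ∂(Measure.pi (fun _ : Fin d => gaussianReal 0 1))
      = if i = j then 1 else 0 := by
  have hz : ∀ x : Fin d → ℝ, hessianEntry (fun _ => (1 : ℝ)) x i j = 0 := by
    intro x; simp [hessianEntry]
  have := stein_pi (fun _ : Fin d → ℝ => (1 : ℝ)) contDiff_const i j (integrable_const _)
    (by simpa using coord_integrable i j) (by simp [hz])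
  simp only [hz, mul_one] at this
  simp at this
  linarith

/-- **Second-order multivariate Stein identity (pHd, Li 1992; identity-covariance case).**
If `X` is standard Gaussian on ℝ^d and `f` is `C²` with the stated integrability, then
entrywise `E[(f(X) − E[f(X)]) X Xᵀ] = E[∇²f(X)]`; that is,
`Σ_{yxx} := E[(f(X) − E f(X))(X − E X)(X − E X)ᵀ]` equals the mean Hessian `E[∇²f(X)]`. -/
theorem stein_phd_identity
    {Ω : Type*} [MeasurableSpace Ω] (P : Measure Ω) [IsProbabilityMeasure P]
    (d : ℕ) (X : Ω → (Fin d → ℝ)) (hX : Measurable X)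
    (hlaw : Measure.map X P = Measure.pi (fun _ : Fin d => gaussianReal 0 1))
    (f : (Fin d → ℝ) → ℝ) (hf : ContDiff ℝ 2 f)
    (hint0 : Integrable (fun ω => f (X ω)) P)
    (hint1 : ∀ i j, Integrable (fun ω => X ω i * X ω j * f (X ω)) P)
    (hint2 : ∀ i j, Integrable (fun ω => hessianEntry f (X ω) i j) P) :
    ∀ i j,
      (∫ ω, (f (X ω) - ∫ ω', f (X ω') ∂P) * (X ω i * X ω j) ∂P
        = ∫ ω, hessianEntry f (X ω) i j ∂P)
      ∧ (∫ ω, (f (X ω) - ∫ ω', f (X ω') ∂P)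
            * ((X ω i - ∫ ω', X ω' i ∂P) * (X ω j - ∫ ω', X ω' j ∂P)) ∂P
          = ∫ ω, hessianEntry f (X ω) i j ∂P) := by
  intro i j
  set μ := Measure.pi (fun _ : Fin d => gaussianReal 0 1) with hμ
  have tr : ∀ g : (Fin d → ℝ) → ℝ, Continuous g → ∫ ω, g (X ω) ∂P = ∫ x, g x ∂μ := by
    intro g hg
    rw [← hlaw, integral_map hX.aemeasurable hg.aestronglyMeasurable]
  have ti : ∀ g : (Fin d → ℝ) → ℝ, Continuous g → Integrable (fun ω => g (X ω)) P →
      Integrable g μ := by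
    intro g hg h
    rw [← hlaw]
    exact (integrable_map_measure hg.aestronglyMeasurable hX.aemeasurable).2 h
  have hfc := hf.continuous
  have hHc : Continuous (fun x => hessianEntry f x i j) := by
    have hd : ContDiff ℝ 1 (fun x => fderiv ℝ f x (Pi.single j 1)) :=
      (hf.fderiv_right (m := 1) (by norm_num)).clm_apply contDiff_const
    exact (hd.continuous_fderiv one_ne_zero).clm_apply continuous_const
  have c1 : Continuous (fun x : Fin d → ℝ => x i * x j * f x) := by fun_prop
  have h1 := ti _ c1 (hint1 i j)
  have h0 := ti _ hfc hint0
  have main := stein_pi f hf i j h0 h1 (ti _ hHc (hint2 i j))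
  have hm : ∀ k, ∫ ω, X ω k ∂P = 0 := fun k => by
    rw [tr (fun x => x k) (by fun_prop)]
    exact coord_mean k
  have first : ∫ ω, (f (X ω) - ∫ ω', f (X ω') ∂P) * (X ω i * X ω j) ∂P
        = ∫ ω, hessianEntry f (X ω) i j ∂P := by
    rw [tr f hfc, tr (fun x => hessianEntry f x i j) hHc,
      tr (fun x => (f x - ∫ y, f y ∂μ) * (x i * x j)) (by fun_prop), main]
    have e : (fun x : Fin d → ℝ => (f x - ∫ y, f y ∂μ) * (x i * x j)) = fun x =>
        x i * x j * f x - (∫ y, f y ∂μ) * (x i * x j) := by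
      funext x
      ring
    rw [e, integral_sub h1 ((coord_integrable i j).const_mul _), integral_const_mul,
      coord_cov i j]
    ring
  refine ⟨first, ?_⟩
  simp only [hm, sub_zero]
  exact first
end

section
/- (pHd principal directions lie in the e.d.r. space, identity-covariance Gaussian case.) Let X: Ω → ℝ^d be a random vector whose law is the standard Gaussian measure on ℝ^d, let U ∈ ℝ^{d×p}, and let g: ℝ^p → ℝ be twice continuously differentiable. Define f(x) := g(Uᵀx) and assume f(X), the entries of X Xᵀ f(X), and the entries of ∇²f(X) are integrable. Then the column space of the matrix Σ_{yxx} := E[(f(X) − E[f(X)]) X Xᵀ] is contained in the column space of U; hence every eigenvector of Σ_{yxx} with nonzero eigenvalue lies in the e.d.r. space spanned by the columns of U. -/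
open MeasureTheory ProbabilityTheory Matrix

lemma key_vanish
    {Ω : Type*} [MeasurableSpace Ω] (P : Measure Ω) [IsProbabilityMeasure P]
    (d : ℕ) (X : Ω → (Fin d → ℝ)) (hX : Measurable X)
    (hlaw : Measure.map X P = Measure.pi (fun _ : Fin d => gaussianReal 0 1))
    (f : (Fin d → ℝ) → ℝ) (hfm : Measurable f)
    (hint0 : Integrable (fun ω => f (X ω)) P)
    (hint1 : ∀ i j, Integrable (fun ω => X ω i * X ω j * f (X ω)) P)
    (w : Fin d → ℝ) (hw : w ≠ 0) (hfw : ∀ x (t : ℝ), f (x - t • w) = f x) (j : Fin d) :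
    ∑ i, w i * ∫ ω, (f (X ω) - ∫ ω', f (X ω') ∂P) * (X ω i * X ω j) ∂P = 0 := by
  set m := ∫ ω', f (X ω') ∂P with hm
  have hXi : ∀ i, Measurable (fun ω => X ω i) := fun i => (measurable_pi_apply i).comp hX
  have hmap : ∀ i, Measure.map (fun ω => X ω i) P = gaussianReal 0 1 := by
    intro i
    have := (measurePreserving_eval (fun _ : Fin d => gaussianReal 0 1) i).map_eq
    rw [← hlaw, Measure.map_map (measurable_pi_apply i) hX] at this
    exact this
  have hind : iIndepFun (fun i ω => X ω i) P := by
    rw [iIndepFun_iff_map_fun_eq_pi_map (fun i => (hXi i).aemeasurable)]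
    simp only [hmap]
    exact hlaw
  have hgi : ∀ i, HasGaussianLaw (fun ω => X ω i) P := fun i =>
    ⟨by rw [hmap i]; infer_instance⟩
  have hG : HasGaussianLaw X P := hind.hasGaussianLaw hgi
  have hL2 : ∀ i, MemLp (fun ω => X ω i) 2 P := fun i => (hgi i).memLp_two
  have hmean : ∀ i, ∫ ω, X ω i ∂P = 0 := by
    intro i
    have h := integral_map (μ := P) (hXi i).aemeasurable
      (f := fun x : ℝ => x) (by fun_prop)
    rw [← h, hmap i]
    exact integral_id_gaussianReal
  have hvar : ∀ i, Var[fun ω => X ω i; P] = 1 := by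
    intro i
    have h := variance_map (μ := P) (X := fun x : ℝ => x) (Y := fun ω => X ω i)
      (by fun_prop) (hXi i).aemeasurable
    rw [hmap i] at h
    have h2 := variance_fun_id_gaussianReal (μ := 0) (v := 1)
    rw [h2] at h
    simpa [Function.comp_def] using h.symm
  have hcov : ∀ i k, cov[fun ω => X ω i, fun ω => X ω k; P] = if i = k then 1 else 0 := by
    intro i k
    split_ifs with h
    · subst h
      rw [covariance_self (hXi i).aemeasurable, hvar]
    · exact (hind.indepFun h).covariance_eq_zero (hL2 i) (hL2 k)
  set q : ℝ := ∑ i, w i * w i with hq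
  have hqpos : q ≠ 0 := by
    intro h
    apply hw
    have := (Finset.sum_eq_zero_iff_of_nonneg (fun i _ => mul_self_nonneg (w i))).1 h
    funext i
    simpa using this i (Finset.mem_univ i)
  set W : Ω → ℝ := fun ω => ∑ i, w i * X ω i with hW
  set Y : Fin d → Ω → ℝ := fun k ω => X ω k - (w k / q) * W ω with hY
  have hWm : Measurable W := by
    apply Finset.measurable_fun_sum
    intro i _
    exact (hXi i).const_mul _
  have hYm : Measurable (fun ω k => Y k ω) := by
    apply measurable_pi_lambda
    intro k
    exact (hXi k).sub (hWm.const_mul _)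
  have hWL : MemLp W 2 P := memLp_finsetSum _ (fun i _ => (hL2 i).const_mul _)
  have hcW : ∀ k, cov[W, fun ω => X ω k; P] = w k := by
    intro k
    rw [hW, covariance_fun_sum_left (fun i => (hL2 i).const_mul _) (hL2 k)]
    simp [covariance_const_mul_left, hcov]
  have hcWW : cov[W, W; P] = q := by
    conv_lhs => rw [hW]
    rw [covariance_fun_sum_right (Y := fun ω => ∑ i, w i * X ω i) (fun i => (hL2 i).const_mul _) hWL]
    simp only [covariance_const_mul_right]
    exact Finset.sum_congr rfl (fun i _ => by rw [hcW i])
  have hjoint : HasGaussianLaw (fun ω => ((fun _ : Unit => W ω), (fun k => Y k ω))) P := by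
    let LW : (Fin d → ℝ) →L[ℝ] ℝ := ∑ i, w i • ContinuousLinearMap.proj i
    let L : (Fin d → ℝ) →L[ℝ] ((Unit → ℝ) × (Fin d → ℝ)) :=
      (ContinuousLinearMap.pi (fun _ => LW)).prod
        (ContinuousLinearMap.pi (fun k => ContinuousLinearMap.proj k - (w k / q) • LW))
    have h := hG.map_fun L
    have he : (fun ω => L (X ω)) = (fun ω => ((fun _ : Unit => W ω), (fun k => Y k ω))) := by
      funext ω
      refine Prod.ext (funext fun k => ?_) (funext fun k => ?_) <;> simp [L, LW, Y, W]
    rw [he] at h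
    exact h
  have hI : IndepFun (fun ω (_ : Unit) => W ω) (fun ω k => Y k ω) P := by
    refine HasGaussianLaw.indepFun_of_covariance_eval (X := fun _ : Unit => W) hjoint ?_
    intro _ k
    show cov[W, fun ω => X ω k - (w k / q) * W ω; P] = 0
    rw [covariance_fun_sub_right hWL (hL2 k) (hWL.const_mul _), covariance_const_mul_right,
      hcW, hcWW]
    field_simp
    ring
  have hWmean : ∫ ω, W ω ∂P = 0 := by
    rw [hW, integral_finsetSum _ (fun i _ => ((hgi i).integrable.const_mul _))]
    simp [integral_const_mul, hmean]
  have hfY : ∀ ω, f (fun k => Y k ω) = f (X ω) := by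
    intro ω
    rw [← hfw (X ω) (W ω / q)]
    congr 1
    funext k
    simp only [hY, Pi.sub_apply, Pi.smul_apply, smul_eq_mul]
    ring
  have hWum : Measurable (fun ω (_ : Unit) => W ω) := measurable_pi_lambda _ (fun _ => hWm)
  have h1 : ∫ ω, W ω * ((f (X ω) - m) * Y j ω) ∂P = 0 := by
    have := hI.integral_fun_comp_mul_comp (f := fun u : Unit → ℝ => u ())
      (g := fun y : Fin d → ℝ => (f y - m) * y j) hWum.aemeasurable hYm.aemeasurable
      (measurable_pi_apply ()).aestronglyMeasurable (by fun_prop)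
    simp only [hfY, hWmean, zero_mul] at this
    exact this
  have h2 : ∫ ω, (W ω) ^ 2 * (f (X ω) - m) ∂P = 0 := by
    have := hI.integral_fun_comp_mul_comp (f := fun u : Unit → ℝ => (u ()) ^ 2)
      (g := fun y : Fin d → ℝ => (f y - m)) hWum.aemeasurable hYm.aemeasurable
      ((measurable_pi_apply ()).pow_const 2).aestronglyMeasurable (by fun_prop)
    simp only [hfY] at this
    rw [this, integral_sub hint0 (integrable_const _)]
    simp [hm]
  have hXX : ∀ i k, Integrable (fun ω => (f (X ω) - m) * (X ω i * X ω k)) P := by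
    intro i k
    have ha := (hint1 i k).sub (((hL2 i).integrable_mul (hL2 k)).const_mul m)
    refine ha.congr (Filter.Eventually.of_forall fun ω => ?_)
    simp only [Pi.sub_apply, Pi.mul_apply]
    ring
  have hWX : ∀ k, Integrable (fun ω => (f (X ω) - m) * (W ω * X ω k)) P := by
    intro k
    have ha := integrable_finsetSum Finset.univ (fun i _ => (hXX i k).const_mul (w i))
    refine ha.congr (Filter.Eventually.of_forall fun ω => ?_)
    simp only [hW, Finset.sum_mul, Finset.mul_sum]
    exact Finset.sum_congr rfl fun i _ => by ring
  have hWW : Integrable (fun ω => (W ω) ^ 2 * (f (X ω) - m)) P := by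
    have ha := integrable_finsetSum Finset.univ (fun i _ => (hWX i).const_mul (w i))
    refine ha.congr (Filter.Eventually.of_forall fun ω => ?_)
    have : (W ω) ^ 2 * (f (X ω) - m) = (f (X ω) - m) * W ω * ∑ i, w i * X ω i := by
      simp only [hW]; ring
    beta_reduce
    rw [this, Finset.mul_sum]
    exact Finset.sum_congr rfl fun i _ => by ring
  have hWY : Integrable (fun ω => W ω * ((f (X ω) - m) * Y j ω)) P := by
    have ha := (hWX j).sub (hWW.const_mul (w j / q))
    refine ha.congr (Filter.Eventually.of_forall fun ω => ?_)
    simp only [hY, Pi.sub_apply]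
    ring
  calc _ = ∫ ω, (f (X ω) - m) * (W ω * X ω j) ∂P := by
        simp only [← integral_const_mul]
        rw [← integral_finsetSum _ (fun i _ => (hXX i j).const_mul (w i))]
        congr 1
        funext ω
        simp only [hW, Finset.sum_mul, Finset.mul_sum]
        exact Finset.sum_congr rfl fun i _ => by ring
    _ = ∫ ω, (W ω * ((f (X ω) - m) * Y j ω) + (w j / q) * ((W ω) ^ 2 * (f (X ω) - m))) ∂P := by
        congr 1
        funext ω
        simp only [hY]
        ring
    _ = 0 := by
        rw [integral_add hWY (hWW.const_mul _), integral_const_mul, h1, h2]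
        simp

/-- **pHd principal directions lie in the e.d.r. space (identity-covariance Gaussian
case).** If `X` is standard Gaussian on ℝ^d and `f(x) = g(Uᵀx)` with `g` of class `C²`,
then the column space of `Σ_{yxx} := E[(f(X) − E f(X)) X Xᵀ]` is contained in the column
space of `U`; hence every eigenvector of `Σ_{yxx}` with nonzero eigenvalue lies in the
e.d.r. space spanned by the columns of `U`. -/
theorem phd_directions_in_edr_space
    {Ω : Type*} [MeasurableSpace Ω] (P : Measure Ω) [IsProbabilityMeasure P]
    (d p : ℕ) (X : Ω → (Fin d → ℝ)) (hX : Measurable X)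
    (hlaw : Measure.map X P = Measure.pi (fun _ : Fin d => gaussianReal 0 1))
    (U : Matrix (Fin d) (Fin p) ℝ)
    (g : (Fin p → ℝ) → ℝ) (hg : ContDiff ℝ 2 g)
    (f : (Fin d → ℝ) → ℝ) (hf : f = fun x => g (Uᵀ *ᵥ x))
    (hint0 : Integrable (fun ω => f (X ω)) P)
    (hint1 : ∀ i j, Integrable (fun ω => X ω i * X ω j * f (X ω)) P)
    (hint2 : ∀ i j, Integrable (fun ω => hessianEntry f (X ω) i j) P)
    (Syxx : Matrix (Fin d) (Fin d) ℝ)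
    (hSyxx : ∀ i j, Syxx i j
      = ∫ ω, (f (X ω) - ∫ ω', f (X ω') ∂P) * (X ω i * X ω j) ∂P) :
    LinearMap.range Syxx.mulVecLin ≤ LinearMap.range U.mulVecLin
    ∧ ∀ (v : Fin d → ℝ) (lam : ℝ), lam ≠ 0 → Syxx *ᵥ v = lam • v →
        v ∈ LinearMap.range U.mulVecLin := by
  have hfm : Measurable f := by
    have hgc := hg.continuous
    rw [hf]
    exact (hgc.comp (by fun_prop)).measurable
  have hmain : LinearMap.range Syxx.mulVecLin ≤ LinearMap.range U.mulVecLin := by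
    rintro _ ⟨v, rfl⟩
    by_contra hv
    obtain ⟨φ, hφv, hφ⟩ := Submodule.exists_le_ker_of_notMem hv
    set w : Fin d → ℝ := fun i => φ (Pi.single i 1) with hwdef
    have hφw : ∀ x, φ x = ∑ i, w i * x i := by
      intro x
      rw [LinearMap.pi_apply_eq_sum_univ φ x]
      refine Finset.sum_congr rfl fun i _ => ?_
      rw [smul_eq_mul, mul_comm]
      congr 2
      funext k
      simp [Pi.single_apply, eq_comm]
    have hw : w ≠ 0 := by
      intro h
      apply hφv
      rw [hφw, h]
      simp
    have hUw : Uᵀ *ᵥ w = 0 := by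
      funext k
      have h : φ (U.mulVecLin (Pi.single k 1)) = 0 := hφ ⟨_, rfl⟩
      rw [hφw] at h
      simp only [Matrix.mulVecLin_apply, Matrix.mulVec_single_one, Matrix.col_apply] at h
      simp only [Matrix.mulVec, dotProduct, Matrix.transpose_apply, Pi.zero_apply]
      rw [← h]
      exact Finset.sum_congr rfl fun i _ => mul_comm _ _
    have hfw : ∀ x (t : ℝ), f (x - t • w) = f x := by
      intro x t
      rw [hf]
      simp only [Matrix.mulVec_sub, Matrix.mulVec_smul, hUw, smul_zero, sub_zero]
    have key := key_vanish P d X hX hlaw f hfm hint0 hint1 w hw hfw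
    simp only [← hSyxx] at key
    apply hφv
    rw [hφw]
    simp only [Matrix.mulVecLin_apply, Matrix.mulVec, dotProduct, Finset.mul_sum]
    rw [Finset.sum_comm]
    refine Finset.sum_eq_zero fun j _ => ?_
    simp only [← mul_assoc]
    rw [← Finset.sum_mul, key j, zero_mul]
  refine ⟨hmain, fun v lam hl hv => ?_⟩
  have h1 : lam • v ∈ LinearMap.range U.mulVecLin := hmain ⟨v, hv⟩
  exact (Submodule.smul_mem_iff _ hl).1 h1
end

section
/- (Sufficiency of the PFC reduction, isotropic-noise case; Cook 2007.) Let Y: Ω → ℝ be a random variable, v: ℝ → ℝ^p a measurable function, μ ∈ ℝ^d, σ > 0, and let ε: Ω → ℝ^d be a random vector whose law is the centered Gaussian measure on ℝ^d with covariance σ² I_d (the d-fold product of one-dimensional Gaussians with mean 0 and variance σ²), with ε independent of Y. Let U ∈ ℝ^{d×p} have orthonormal columns and define the covariate X := μ + U v(Y) + ε. Then the reduction X ↦ UᵀX is sufficient: Y and X are conditionally independent given UᵀX. -/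
open MeasureTheory ProbabilityTheory Matrix
open scoped NNReal

theorem indep_assoc {Ω α β γ : Type*} [MeasurableSpace Ω] [MeasurableSpace α] [MeasurableSpace β]
    [MeasurableSpace γ] {P : Measure Ω} [IsProbabilityMeasure P] {A : Ω → α} {B : Ω → β} {C : Ω → γ}
    (hA : Measurable A) (hB : Measurable B) (hC : Measurable C)
    (h1 : IndepFun A B P) (h2 : IndepFun (fun ω => (A ω, B ω)) C P) :
    IndepFun A (fun ω => (B ω, C ω)) P := by
  have := Measure.isProbabilityMeasure_map (μ := P) hA.aemeasurable
  have := Measure.isProbabilityMeasure_map (μ := P) hB.aemeasurable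
  have := Measure.isProbabilityMeasure_map (μ := P) hC.aemeasurable
  have h3 : IndepFun B C P := h2.comp (φ := Prod.snd) (ψ := id) measurable_snd measurable_id
  rw [indepFun_iff_map_prod_eq_prod_map_map (by fun_prop) (by fun_prop)] at *
  rw [h3, ← Measure.prodAssoc_prod, ← h1, ← h2, Measure.map_map (by fun_prop) (by fun_prop)]
  rfl

theorem condDistrib_indep {Ω α β γ : Type*} [MeasurableSpace Ω] [MeasurableSpace α]
    [MeasurableSpace β] [MeasurableSpace γ] [StandardBorelSpace γ] [Nonempty γ]
    {P : Measure Ω} [IsProbabilityMeasure P] {Z : Ω → α} {W : Ω → β}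
    (hZ : Measurable Z) (hW : Measurable W) (h : IndepFun Z W P) (F : α → β → γ)
    (hF : Measurable (Function.uncurry F)) (κ : Kernel α γ) [IsFiniteKernel κ]
    (hκ : ∀ z, κ z = (P.map W).map (F z)) :
    condDistrib (fun ω => F (Z ω) (W ω)) Z P =ᵐ[P.map Z] κ := by
  have hm : Measurable (fun ω => F (Z ω) (W ω)) := hF.comp (hZ.prodMk hW)
  have hFz (z) : Measurable (F z) := hF.comp (measurable_const.prodMk measurable_id)
  have := Measure.isProbabilityMeasure_map (μ := P) hZ.aemeasurable
  have := Measure.isProbabilityMeasure_map (μ := P) hW.aemeasurable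
  apply condDistrib_ae_eq_of_measure_eq_compProd _ hm.aemeasurable
  rw [indepFun_iff_map_prod_eq_prod_map_map (by fun_prop) (by fun_prop)] at h
  have hG : Measurable (fun q : α × β => (q.1, F q.1 q.2)) := measurable_fst.prodMk hF
  have : P.map (fun ω => (Z ω, F (Z ω) (W ω)))
      = ((P.map Z).prod (P.map W)).map (fun q : α × β => (q.1, F q.1 q.2)) := by
    rw [← h, Measure.map_map hG (by fun_prop)]
    rfl
  rw [this]
  ext s hs
  rw [Measure.map_apply hG hs, Measure.prod_apply (hG hs), Measure.compProd_apply hs]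
  congr 1 with z
  rw [hκ, Measure.map_apply (hFz z) (measurable_prodMk_left hs)]
  rfl

theorem condIndep_of {Ω α β γ δ : Type*} [MeasurableSpace Ω] [StandardBorelSpace Ω]
    [MeasurableSpace α]
    [MeasurableSpace β] [MeasurableSpace γ] [StandardBorelSpace γ] [Nonempty γ]
    [MeasurableSpace δ] [StandardBorelSpace δ] [Nonempty δ]
    {P : Measure Ω} [IsProbabilityMeasure P] {T : Ω → α} {Y : Ω → δ} {W : Ω → β}
    (hT : Measurable T) (hY : Measurable Y) (hW : Measurable W)
    (h : IndepFun (fun ω => (T ω, Y ω)) W P) (F : α → β → γ)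
    (hF : Measurable (Function.uncurry F)) :
    CondIndepFun (MeasurableSpace.comap T inferInstance) hT.comap_le Y
      (fun ω => F (T ω) (W ω)) P := by
  have := Measure.isProbabilityMeasure_map (μ := P) hW.aemeasurable
  have hm : Measurable (fun ω => F (T ω) (W ω)) := hF.comp (hT.prodMk hW)
  have hFz (z) : Measurable (F z) := hF.comp (measurable_const.prodMk measurable_id)
  rw [condIndepFun_iff_condDistrib_prod_ae_eq_prodMkRight hm hY hT]
  let κ : Kernel α γ := (Kernel.id ×ₖ Kernel.const α (P.map W)).map (Function.uncurry F)
  have : IsMarkovKernel κ := Kernel.IsMarkovKernel.map _ hF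
  have hκ (z) : κ z = (P.map W).map (F z) := by
    simp only [κ]
    rw [Kernel.map_apply _ hF, Kernel.prod_apply, Kernel.id_apply, Kernel.const_apply,
      Measure.dirac_prod, Measure.map_map hF (by fun_prop)]
    rfl
  have e1 := condDistrib_indep hT hW
    (h.comp (φ := Prod.fst) (ψ := id) measurable_fst measurable_id) F hF κ hκ
  have e2 := condDistrib_indep (hT.prodMk hY) hW h (fun z w => F z.1 w)
    (hF.comp (by fun_prop : Measurable fun q : (α × δ) × β => (q.1.1, q.2))) (κ.prodMkRight δ)
    (fun z => by rw [Kernel.prodMkRight_apply, hκ])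
  refine e2.trans ?_
  have hq : P.map T = (P.map (fun ω => (T ω, Y ω))).map Prod.fst := by
    rw [Measure.map_map measurable_fst (by fun_prop)]; rfl
  rw [hq] at e1
  filter_upwards [ae_of_ae_map measurable_fst.aemeasurable e1] with z hz
  rw [Kernel.prodMkRight_apply, Kernel.prodMkRight_apply, hz]

theorem gauss_indep {Ω : Type*} [MeasurableSpace Ω] {P : Measure Ω} [IsProbabilityMeasure P]
    {d p q : ℕ} {s : ℝ≥0} {ε : Ω → (Fin d → ℝ)} (hε : Measurable ε)
    (hlaw : Measure.map ε P = Measure.pi (fun _ : Fin d => gaussianReal 0 s))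
    (A : Matrix (Fin p) (Fin d) ℝ) (B : Matrix (Fin q) (Fin d) ℝ) (hAB : A * Bᵀ = 0) :
    IndepFun (fun ω => A *ᵥ ε ω) (fun ω => B *ᵥ ε ω) P := by
  have hm (i) : Measurable (fun ω => ε ω i) := by fun_prop
  have hl (i) : P.map (fun ω => ε ω i) = gaussianReal 0 s := by
    have : (fun ω => ε ω i) = (Function.eval i) ∘ ε := rfl
    rw [this, ← Measure.map_map (by fun_prop) hε, hlaw, Measure.pi_map_eval]
    simp
  have hg (i) : HasGaussianLaw (fun ω => ε ω i) P := ⟨by rw [hl]; infer_instance⟩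
  have hi : iIndepFun (fun i ω => ε ω i) P := by
    rw [iIndepFun_iff_map_fun_eq_pi_map (fun i => (hm i).aemeasurable)]
    simp_rw [hl]
    exact hlaw
  have hG : HasGaussianLaw ε P := hi.hasGaussianLaw hg
  have hv (i) : Var[fun ω => ε ω i; P] = s := by
    have := variance_fun_id_gaussianReal (μ := 0) (v := s)
    rw [← hl i, variance_map (by fun_prop) (hm i).aemeasurable] at this
    exact this
  have hc (i j) : cov[fun ω => ε ω i, fun ω => ε ω j; P] = if i = j then (s : ℝ) else 0 := by
    split_ifs with hij
    · subst hij
      rw [covariance_self (hm i).aemeasurable, hv]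
    · exact (hi.indepFun hij).covariance_eq_zero (hg i).memLp_two (hg j).memLp_two
  apply HasGaussianLaw.indepFun_of_covariance_eval (X := fun i ω => (A *ᵥ ε ω) i)
    (Y := fun i ω => (B *ᵥ ε ω) i)
  · exact hG.map ((A.mulVecLin.prod B.mulVecLin).toContinuousLinearMap)
  · intro i j
    simp only [Matrix.mulVec, dotProduct]
    rw [covariance_fun_sum_fun_sum (fun k => (hg k).memLp_two.const_mul _)
      (fun k => (hg k).memLp_two.const_mul _)]
    simp_rw [covariance_const_mul_left, covariance_const_mul_right, hc]
    have := congrFun (congrFun hAB i) j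
    simp only [Matrix.mul_apply, Matrix.transpose_apply, Matrix.zero_apply] at this
    simp
    simp_rw [← mul_assoc, ← Finset.sum_mul, this, zero_mul]

theorem pfc_sufficiency
    {Ω : Type*} [mΩ : MeasurableSpace Ω] [StandardBorelSpace Ω]
    (P : Measure Ω) [IsProbabilityMeasure P]
    (d p : ℕ) (Y : Ω → ℝ) (hY : Measurable Y)
    (v : ℝ → (Fin p → ℝ)) (hv : Measurable v)
    (μ : Fin d → ℝ) (σ : ℝ≥0) (hσ : 0 < σ)
    (ε : Ω → (Fin d → ℝ)) (hε : Measurable ε)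
    (hlaw : Measure.map ε P = Measure.pi (fun _ : Fin d => gaussianReal 0 (σ ^ 2)))
    (hindep : IndepFun ε Y P)
    (U : Matrix (Fin d) (Fin p) ℝ) (hU : Uᵀ * U = 1)
    (X : Ω → (Fin d → ℝ)) (hXdef : X = fun ω => μ + U *ᵥ v (Y ω) + ε ω)
    (hmU : MeasurableSpace.comap (fun ω => Uᵀ *ᵥ X ω) inferInstance ≤ mΩ) :
    CondIndepFun (MeasurableSpace.comap (fun ω => Uᵀ *ᵥ X ω) inferInstance) hmU Y X P := by
  have hmv {m n : ℕ} (A : Matrix (Fin m) (Fin n) ℝ) : Measurable (fun x : Fin n → ℝ => A *ᵥ x) :=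
    (Continuous.matrix_mulVec continuous_const continuous_id).measurable
  let R : Matrix (Fin d) (Fin d) ℝ := 1 - U * Uᵀ
  have hRU : R * U = 0 := by
    simp only [R, Matrix.sub_mul, Matrix.mul_assoc, hU, Matrix.mul_one, Matrix.one_mul, sub_self]
  have h1 : IndepFun (fun ω => R *ᵥ ε ω) (fun ω => Uᵀ *ᵥ ε ω) P :=
    gauss_indep hε hlaw R Uᵀ (by rw [Matrix.transpose_transpose, hRU])
  have h2 : IndepFun (fun ω => (R *ᵥ ε ω, Uᵀ *ᵥ ε ω)) Y P :=
    hindep.comp (φ := fun x => (R *ᵥ x, Uᵀ *ᵥ x)) (ψ := id) ((hmv R).prodMk (hmv Uᵀ)) measurable_id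
  have hRm : Measurable (fun ω => R *ᵥ ε ω) := (hmv R).comp hε
  have hUm : Measurable (fun ω => Uᵀ *ᵥ ε ω) := (hmv Uᵀ).comp hε
  have h3 := (indep_assoc hRm hUm hY h1 h2).symm
  have hT (ω) : Uᵀ *ᵥ X ω = Uᵀ *ᵥ μ + v (Y ω) + Uᵀ *ᵥ ε ω := by
    simp [hXdef, Matrix.mulVec_add, Matrix.mulVec_mulVec, hU]
  have h4 : IndepFun (fun ω => (Uᵀ *ᵥ X ω, Y ω)) (fun ω => R *ᵥ ε ω) P := by
    simp_rw [hT]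
    exact h3.comp (φ := fun q : (Fin p → ℝ) × ℝ => (Uᵀ *ᵥ μ + v q.2 + q.1, q.2)) (ψ := id)
      (by fun_prop) measurable_id
  have hTm : Measurable (fun ω => Uᵀ *ᵥ X ω) := by
    simp_rw [hT]; fun_prop
  have hX : X = fun ω => U *ᵥ (Uᵀ *ᵥ X ω) + R *ᵥ μ + R *ᵥ ε ω := by
    funext ω
    have hRv : R *ᵥ (U *ᵥ v (Y ω)) = 0 := by rw [Matrix.mulVec_mulVec, hRU, Matrix.zero_mulVec]
    have h5 : R *ᵥ X ω = R *ᵥ μ + R *ᵥ ε ω := by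
      simp only [hXdef, Matrix.mulVec_add, hRv, add_zero]
    rw [add_assoc, ← h5]
    simp only [R, Matrix.sub_mulVec, Matrix.one_mulVec, Matrix.mulVec_mulVec, add_sub_cancel]
  have key := condIndep_of hTm hY hRm h4 (fun t w => U *ᵥ t + R *ᵥ μ + w)
    ((((hmv U).comp measurable_fst).add_const _).add measurable_snd)
  convert key
end
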